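/- Fix L > 0, δ = δ₂/4, and let R₀ ≥ 1, h̃ ∈ (0,1/24], a₁ > 0, m₁ ∈ (0,1], δ₁ ∈ (0,1/2] be the constants (depending on L only) from the Gaussian boundary-localization estimates. Let ψ be a function with either ψ ∈ C¹(ℝ²) ∩ W^{1,1}(ℝ²) or ψ ∈ W^{2,1}(ℝ²), with ‖ψ‖_{W^{1,1}(ℝ²)} ≤ δ̃ where δ̃ ≤ min{h̃, a₁/2}, and set G̃ = G + ψ. For any s with 0 < s ≤ 1, let r = s R₀ and let D ⊂ ℝ² be a bounded open set which is Lipschitz with constants r and L. Let v_s = χ_D ∗ G̃_s, where G̃_s(x) = s^{−2} G̃(x/s). Then: (i) for every x ∈ ℝ², if 2h̃ < v_s(x) < 1 − 2h̃ then dist(x, ∂D) ≤ m₁ δ r; (ii) for every x ∈ ∂D, in the local coordinate system at x, for every y with |y₁| ≤ δ₁ r and φ(y₁) − δr ≤ y₂ ≤ φ(y₁) + δr one has ∇v_s(y)·(−e₂) ≥ a₁/(2s). -/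

import Mathlib

open MeasureTheory Metric Set

noncomputable section

abbrev E2 : Type := EuclideanSpace ℝ (Fin 2)

/-- A bounded open set `Ω ⊆ ℝ²` is Lipschitz with constants `r` and `L`. -/
def IsLipDomain (r L : ℝ) (Ω : Set E2) : Prop :=
  ∀ x ∈ frontier Ω, ∃ (A : E2 ≃ᵢ E2) (φ : ℝ → ℝ),
    A x = 0 ∧ LipschitzWith (Real.toNNReal L) φ ∧ φ 0 = 0 ∧
    ∀ y ∈ ball x r, (y ∈ Ω ↔ (A y) 1 < φ ((A y) 0))

/-- The standard Gaussian on the plane, `G x = (2π)⁻¹ exp (-|x|²/2)`. -/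
def Gauss : E2 → ℝ := fun x => (2 * Real.pi)⁻¹ * Real.exp (-‖x‖ ^ 2 / 2)

/-- Convolution `χ_D ∗ K` of the characteristic function of `D` with a kernel `K`. -/
def convK (D : Set E2) (K : E2 → ℝ) (x : E2) : ℝ :=
  ∫ y, D.indicator (fun _ => (1 : ℝ)) y * K (x - y)

/-- `g` is the weak partial derivative of `f` in the direction of the `i`-th coordinate. -/
def IsWeakPartialDeriv (i : Fin 2) (f g : E2 → ℝ) : Prop :=
  ∀ φ : E2 → ℝ, ContDiff ℝ (⊤ : ℕ∞) φ → HasCompactSupport φ →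
    ∫ x, f x * fderiv ℝ φ x (EuclideanSpace.single i 1) = -∫ x, g x * φ x

open Filter Topology

lemma aux_ind_meas (D : Set E2) (hDo : IsOpen D) :
    Measurable (D.indicator (fun _ => (1 : ℝ))) :=
  measurable_const.indicator hDo.measurableSet

lemma aux_ind_bd (D : Set E2) (x : E2) :
    0 ≤ D.indicator (fun _ => (1 : ℝ)) x ∧ D.indicator (fun _ => (1 : ℝ)) x ≤ 1 := by
  by_cases h : x ∈ D <;> simp [h]

lemma aux_int (c : E2 → ℝ) (hc : Measurable c) (hb : ∀ x, 0 ≤ c x ∧ c x ≤ 1)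
    (K : E2 → ℝ) (hK : Integrable K) (x : E2) : Integrable (fun y => c y * K (x - y)) :=
  (hK.comp_sub_left x).bdd_mul (c := 1) hc.aestronglyMeasurable
    (Eventually.of_forall fun y => by
      rw [Real.norm_eq_abs, abs_of_nonneg (hb y).1]; exact (hb y).2)

lemma aux_convK_bd (D : Set E2) (hDo : IsOpen D) (K : E2 → ℝ) (hK : Integrable K) (x : E2) :
    |convK D K x| ≤ ∫ z, |K z| := by
  unfold convK
  rw [← integral_sub_left_eq_self (fun z => |K z|) volume x]
  refine (abs_integral_le_integral_abs).trans ?_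
  refine integral_mono (aux_int _ (aux_ind_meas D hDo) (aux_ind_bd D) K hK x).abs
    (hK.comp_sub_left x).abs ?_
  intro y
  have := aux_ind_bd D y
  simp only [abs_mul]
  rw [abs_of_nonneg this.1]
  exact mul_le_of_le_one_left (abs_nonneg _) this.2

lemma aux_approx (D : Set E2) (hDo : IsOpen D) (hDb : Bornology.IsBounded D) :
    ∃ χ : ℕ → E2 → ℝ, (∀ n, ContDiff ℝ (⊤ : ℕ∞) (χ n)) ∧ (∀ n, HasCompactSupport (χ n)) ∧
      (∀ n x, 0 ≤ χ n x ∧ χ n x ≤ 1) ∧ (∀ n x, x ∉ D → χ n x = 0) ∧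
      ∀ x, Tendsto (fun n => χ n x) atTop (𝓝 (D.indicator (fun _ => (1 : ℝ)) x)) := by
  obtain ⟨f, hf, hfd, hfr⟩ := hDo.exists_contDiff_support_eq (n := ⊤)
  have h0 : ∀ x, 0 ≤ f x := fun x => (hfr ⟨x, rfl⟩).1
  have hz : ∀ x, x ∉ D → f x = 0 := fun x hx => by
    rw [← hf] at hx; simpa using hx
  have hz' : ∀ n : ℕ, ∀ x, x ∉ D → Real.smoothTransition (n * f x) = 0 := fun n x hx => by
    simp [hz x hx]
  refine ⟨fun n x => Real.smoothTransition (n * f x), ?_, ?_, ?_, hz', ?_⟩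
  · intro n
    exact Real.smoothTransition.contDiff.comp (contDiff_const.mul hfd)
  · intro n
    refine HasCompactSupport.intro hDb.isCompact_closure ?_
    intro x hx
    exact hz' n x fun h => hx (subset_closure h)
  · intro n x
    exact ⟨Real.smoothTransition.nonneg _, Real.smoothTransition.le_one _⟩
  · intro x
    by_cases hx : x ∈ D
    · have hpos : 0 < f x := lt_of_le_of_ne (h0 x) (Ne.symm (by rw [← hf] at hx; exact hx))
      simp only [indicator_of_mem hx]
      refine tendsto_const_nhds.congr' ?_
      obtain ⟨N, hN⟩ := exists_nat_gt (1 / f x)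
      filter_upwards [eventually_ge_atTop N] with n hn
      symm
      apply Real.smoothTransition.one_of_one_le
      rw [div_lt_iff₀ hpos] at hN
      have : (N : ℝ) ≤ n := by exact_mod_cast hn
      nlinarith
    · simp [hz x hx, hx]

lemma aux_unif (D : Set E2) (hDo : IsOpen D) (hDb : Bornology.IsBounded D) (χ : ℕ → E2 → ℝ)
    (hm : ∀ n, Measurable (χ n)) (hb : ∀ n x, 0 ≤ χ n x ∧ χ n x ≤ 1)
    (hz : ∀ n x, x ∉ D → χ n x = 0)
    (ht : ∀ x, Tendsto (fun n => χ n x) atTop (𝓝 (D.indicator (fun _ => (1 : ℝ)) x)))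
    (g : E2 → ℝ) (hg : Integrable g) (ε : ℝ) (hε : 0 < ε) :
    ∀ᶠ n in atTop, ∀ x, |(∫ y, χ n y * g (x - y)) - convK D g x| < ε := by
  set c := D.indicator (fun _ => (1 : ℝ)) with hc
  have hcm : Measurable c := aux_ind_meas D hDo
  have hcb := aux_ind_bd D
  rw [← hc] at hcb
  have hci : Integrable c := by
    rw [hc, integrable_indicator_iff hDo.measurableSet]
    exact integrableOn_const hDb.measure_lt_top.ne
  have hle : ∀ n y, |χ n y - c y| ≤ c y := by
    intro n y
    by_cases hy : y ∈ D
    · have : c y = 1 := by simp [hc, hy]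
      rw [this, abs_le]; constructor <;> linarith [(hb n y).1, (hb n y).2]
    · have : c y = 0 := by simp [hc, hy]
      simp [this, hz n y hy]
  have hle1 : ∀ n y, |χ n y - c y| ≤ 1 := fun n y => (hle n y).trans (hcb y).2
  have hdi : ∀ n, Integrable (fun y => |χ n y - c y|) := fun n =>
    hci.mono' ((hm n).sub hcm).abs.aestronglyMeasurable
      (Eventually.of_forall fun y => by simpa using hle n y)
  have hlim : Tendsto (fun n => ∫ y, |χ n y - c y|) atTop (𝓝 0) := by
    have := tendsto_integral_of_dominated_convergence (μ := volume)
      (F := fun n y => |χ n y - c y|) (f := fun _ => (0 : ℝ)) c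
      (fun n => (hdi n).aestronglyMeasurable) hci
      (fun n => Eventually.of_forall fun y => by simpa using hle n y)
      (Eventually.of_forall fun y => by
        have := ((ht y).sub_const (c y)).abs
        simpa using this)
    simpa using this
  obtain ⟨k, hks, hkε, hkc, hki⟩ := hg.exists_hasCompactSupport_integral_sub_le (half_pos hε)
  obtain ⟨M, hM⟩ := hkc.bounded_above_of_compact_support hks
  have hM0 : 0 ≤ M := (norm_nonneg _).trans (hM 0)
  have hlim2 : Tendsto (fun n => M * ∫ y, |χ n y - c y|) atTop (𝓝 0) := by
    simpa using hlim.const_mul M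
  filter_upwards [hlim2.eventually (gt_mem_nhds (half_pos hε))] with n hn x
  have e1 : (∫ y, χ n y * g (x - y)) - convK D g x = ∫ y, (χ n y - c y) * g (x - y) := by
    unfold convK
    rw [← integral_sub (aux_int _ (hm n) (hb n) g hg x) (aux_int _ hcm hcb g hg x)]
    congr 1; ext y; ring
  rw [e1]
  have hgk : Integrable (fun y => |g (x - y) - k (x - y)|) :=
    ((hg.sub hki).comp_sub_left x).abs
  calc |∫ y, (χ n y - c y) * g (x - y)| ≤ ∫ y, |(χ n y - c y) * g (x - y)| :=
        abs_integral_le_integral_abs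
    _ ≤ ∫ y, (|g (x - y) - k (x - y)| + M * |χ n y - c y|) := by
        refine integral_mono_of_nonneg (Eventually.of_forall fun y => abs_nonneg _)
          (hgk.add ((hdi n).const_mul M)) (Eventually.of_forall fun y => ?_)
        have h1 := hle1 n y
        have h2 := hM (x - y)
        rw [Real.norm_eq_abs] at h2
        have h3 : |g (x - y)| ≤ |g (x - y) - k (x - y)| + |k (x - y)| := by
          have := abs_add_le (g (x - y) - k (x - y)) (k (x - y)); simpa using this
        have h4 := abs_nonneg (χ n y - c y)
        have h5 := abs_nonneg (g (x - y) - k (x - y))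
        simp only [abs_mul]
        nlinarith
    _ = (∫ y, |g (x - y) - k (x - y)|) + M * ∫ y, |χ n y - c y| := by
        rw [integral_add hgk ((hdi n).const_mul M), integral_const_mul]
    _ < ε := by
        rw [integral_sub_left_eq_self (fun z => |g z - k z|) volume x]
        simp only [Real.norm_eq_abs] at hkε
        linarith

/-- The candidate gradient of a convolution. -/
def auxLin (a : Fin 2 → ℝ) : E2 →L[ℝ] ℝ := ∑ i, a i • (EuclideanSpace.proj i : E2 →L[ℝ] ℝ)

lemma auxLin_apply (a : Fin 2 → ℝ) (w : E2) : auxLin a w = ∑ i, a i * w i := by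
  simp [auxLin]

lemma aux_coord (w : E2) (i : Fin 2) : |w i| ≤ ‖w‖ := by
  simpa using PiLp.norm_apply_le w i

lemma aux_smooth_deriv (ψ : E2 → ℝ) (ψ' : Fin 2 → E2 → ℝ) (hψint : Integrable ψ)
    (hψ' : ∀ i, IsWeakPartialDeriv i ψ (ψ' i) ∧ Integrable (ψ' i))
    (χ : E2 → ℝ) (hd : ContDiff ℝ (⊤ : ℕ∞) χ) (hs : HasCompactSupport χ) (x : E2) :
    HasFDerivAt (fun x => ∫ y, χ y * ψ (x - y))
      (auxLin fun i => ∫ y, χ y * ψ' i (x - y)) x := by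
  have hd1 : ContDiff ℝ 1 χ := hd.of_le (by exact_mod_cast le_top)
  have key := hs.hasFDerivAt_convolution_right (ContinuousLinearMap.mul ℝ ℝ)
    hψint.locallyIntegrable hd1 x
  have hfun : (fun x => ∫ y, χ y * ψ (x - y)) =
      convolution ψ χ (ContinuousLinearMap.mul ℝ ℝ) volume := by
    ext z
    rw [convolution_def, ← integral_sub_left_eq_self (fun y => χ y * ψ (z - y)) volume z]
    congr 1; ext t
    simp [mul_comm]
  rw [hfun]
  suffices heq : (auxLin fun i => ∫ y, χ y * ψ' i (x - y)) = convolution ψ (fderiv ℝ χ)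
      (ContinuousLinearMap.precompR E2 (ContinuousLinearMap.mul ℝ ℝ)) volume x by
    rw [heq]; exact key
  have hbas : ∀ i : Fin 2, convolution ψ (fderiv ℝ χ)
      (ContinuousLinearMap.precompR E2 (ContinuousLinearMap.mul ℝ ℝ)) volume x
        (EuclideanSpace.single i 1) = ∫ y, χ y * ψ' i (x - y) := by
    intro i
    rw [convolution_precompR_apply _ hψint.locallyIntegrable (hs.fderiv ℝ)
      (hd1.continuous_fderiv one_ne_zero), convolution_def]
    have hw := (hψ' i).1 (fun t => χ (x - t)) (hd.comp (contDiff_const.sub contDiff_id))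
      (hs.comp_homeomorph (Homeomorph.subLeft x))
    have hfd : ∀ t, fderiv ℝ (fun t => χ (x - t)) t (EuclideanSpace.single i 1) =
        - fderiv ℝ χ (x - t) (EuclideanSpace.single i 1) := by
      intro t
      have h1 : HasFDerivAt χ (fderiv ℝ χ (x - t)) (x - t) :=
        (hd1.differentiable one_ne_zero _).hasFDerivAt
      have h2 : HasFDerivAt (fun t => x - t) (-(ContinuousLinearMap.id ℝ E2)) t :=
        (hasFDerivAt_id t).const_sub x
      have h3 : HasFDerivAt (fun t => χ (x - t)) _ t := h1.comp t h2
      rw [h3.fderiv]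
      simp
    simp only [hfd, mul_neg, integral_neg, neg_inj] at hw
    simp only [ContinuousLinearMap.mul_apply']
    rw [hw, ← integral_sub_left_eq_self (fun y => χ y * ψ' i (x - y)) volume x]
    congr 1; ext t
    simp [mul_comm]
  refine ContinuousLinearMap.ext fun w => ?_
  have hwd : w = ∑ i, w i • EuclideanSpace.single i (1 : ℝ) := by
    ext j; fin_cases j <;> simp
  rw [auxLin_apply]
  conv_rhs => rw [hwd]
  rw [map_sum]
  refine Finset.sum_congr rfl fun i _ => ?_
  rw [map_smul, hbas, smul_eq_mul, mul_comm]

lemma aux_deriv (D : Set E2) (hDo : IsOpen D) (hDb : Bornology.IsBounded D)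
    (ψ : E2 → ℝ) (ψ' : Fin 2 → E2 → ℝ) (hψint : Integrable ψ)
    (hψ' : ∀ i, IsWeakPartialDeriv i ψ (ψ' i) ∧ Integrable (ψ' i)) (x : E2) :
    HasFDerivAt (convK D ψ) (auxLin fun i => convK D (ψ' i) x) x := by
  obtain ⟨χ, hd, hs, hb, hz, ht⟩ := aux_approx D hDo hDb
  have hm : ∀ n, Measurable (χ n) := fun n => (hd n).continuous.measurable
  refine hasFDerivAt_of_tendstoUniformly (l := atTop)
    (f := fun n x => ∫ y, χ n y * ψ (x - y))
    (f' := fun n x => auxLin fun i => ∫ y, χ n y * ψ' i (x - y))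
    (g' := fun x => auxLin fun i => convK D (ψ' i) x) ?_
    (fun n x => aux_smooth_deriv ψ ψ' hψint hψ' (χ n) (hd n) (hs n) x) ?_ x
  · rw [Metric.tendstoUniformly_iff]
    intro ε hε
    filter_upwards [aux_unif D hDo hDb χ hm hb hz ht (ψ' 0) (hψ' 0).2 (ε / 4) (by positivity),
      aux_unif D hDo hDb χ hm hb hz ht (ψ' 1) (hψ' 1).2 (ε / 4) (by positivity)] with n h0 h1 z
    rw [dist_comm, dist_eq_norm]
    refine lt_of_le_of_lt (ContinuousLinearMap.opNorm_le_bound _ (M := ε / 2) (by positivity) ?_)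
      (half_lt_self hε)
    intro w
    have e : (auxLin (fun i => ∫ y, χ n y * ψ' i (z - y)) - auxLin fun i => convK D (ψ' i) z) w
      = ((∫ y, χ n y * ψ' 0 (z - y)) - convK D (ψ' 0) z) * w 0 +
        ((∫ y, χ n y * ψ' 1 (z - y)) - convK D (ψ' 1) z) * w 1 := by
      rw [sub_apply, auxLin_apply, auxLin_apply, Fin.sum_univ_two,
        Fin.sum_univ_two]
      ring
    rw [e, Real.norm_eq_abs]
    refine (abs_add_le _ _).trans ?_
    rw [abs_mul, abs_mul]
    have a0 := mul_le_mul (h0 z).le (aux_coord w 0) (abs_nonneg _) (by positivity)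
    have a1 := mul_le_mul (h1 z).le (aux_coord w 1) (abs_nonneg _) (by positivity)
    linarith
  · intro z
    rw [Metric.tendsto_nhds]
    intro ε hε
    filter_upwards [aux_unif D hDo hDb χ hm hb hz ht ψ hψint ε hε] with n hn
    exact hn z

lemma aux_gauss_int : Integrable Gauss := by
  have h := GaussianFourier.integrable_cexp_neg_mul_sq_norm_add (V := E2) (b := (1 / 2 : ℂ))
    (by norm_num) 0 0
  have h2 := h.re.const_mul (2 * Real.pi)⁻¹
  refine h2.congr (Eventually.of_forall fun x => ?_)
  have : Complex.exp (-(1 / 2 : ℂ) * (‖x‖ : ℂ) ^ 2 + 0 * ((inner ℝ (0 : E2) x : ℝ) : ℂ)) =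
      ((Real.exp (-‖x‖ ^ 2 / 2) : ℝ) : ℂ) := by
    push_cast; congr 1; ring
  simp only [Gauss]
  rw [this]
  rfl

lemma aux_scale (D : Set E2) (K : E2 → ℝ) (s : ℝ) (hs : 0 < s) (x : E2) :
    convK D (fun z => (s⁻¹) ^ 2 * K (s⁻¹ • z)) x =
      convK ((fun y => s • y) ⁻¹' D) K (s⁻¹ • x) := by
  unfold convK
  have h := Measure.integral_comp_smul (volume : Measure E2)
    (fun y => D.indicator (fun _ => (1 : ℝ)) y * ((s⁻¹) ^ 2 * K (s⁻¹ • (x - y)))) s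
  rw [finrank_euclideanSpace_fin, abs_of_nonneg (by positivity), smul_eq_mul] at h
  have h2 : (∫ y, D.indicator (fun _ => (1 : ℝ)) y * ((s⁻¹) ^ 2 * K (s⁻¹ • (x - y)))) =
    s ^ 2 * ∫ y, D.indicator (fun _ => (1 : ℝ)) (s • y) *
      ((s⁻¹) ^ 2 * K (s⁻¹ • (x - s • y))) := by
    rw [h]; field_simp
  rw [h2, ← integral_const_mul]
  congr 1; ext y
  have : s⁻¹ • (x - s • y) = s⁻¹ • x - y := by
    rw [smul_sub, inv_smul_smul₀ hs.ne']
  rw [this]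
  have h3 : (((fun y => s • y) ⁻¹' D).indicator (fun _ => (1 : ℝ)) y) =
    D.indicator (fun _ => (1 : ℝ)) (s • y) := by
    by_cases hy : s • y ∈ D <;> simp [hy]
  rw [h3]; field_simp

/-- The rescaled isometry. -/
def auxIso (A : E2 ≃ᵢ E2) (s : ℝ) (hs : 0 < s) : E2 ≃ᵢ E2 :=
  IsometryEquiv.mk' (fun y => s⁻¹ • A (s • y)) (fun y => s⁻¹ • A.symm (s • y))
    (fun y => by simp [smul_inv_smul₀ hs.ne', inv_smul_smul₀ hs.ne'])
    (Isometry.of_dist_eq fun y z => by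
      rw [dist_smul₀, A.dist_eq, dist_smul₀, norm_inv]
      have : ‖s‖ ≠ 0 := by simpa using hs.ne'
      field_simp)

lemma auxIso_apply (A : E2 ≃ᵢ E2) (s : ℝ) (hs : 0 < s) (y : E2) :
    auxIso A s hs y = s⁻¹ • A (s • y) := rfl

lemma auxIso_symm_apply (A : E2 ≃ᵢ E2) (s : ℝ) (hs : 0 < s) (y : E2) :
    (auxIso A s hs).symm y = s⁻¹ • A.symm (s • y) := rfl

lemma aux_dir (A : E2 ≃ᵢ E2) (y e : E2) :
    A.symm (A y - e) - y = -(A.toRealAffineIsometryEquiv.symm.linearIsometryEquiv e) := by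
  have h := A.toRealAffineIsometryEquiv.symm.map_vadd (A y) (-e)
  have h1 : ∀ z, A.toRealAffineIsometryEquiv.symm z = A.symm z := fun z => by
    apply A.injective
    rw [A.apply_symm_apply]
    have := A.toRealAffineIsometryEquiv.apply_symm_apply z
    rwa [A.coeFn_toRealAffineIsometryEquiv] at this
  rw [h1, h1] at h
  simp only [vadd_eq_add, A.symm_apply_apply, map_neg] at h
  rw [show A y - e = -e + A y by abel, h]
  abel

lemma aux_dir_scale (A : E2 ≃ᵢ E2) (s : ℝ) (hs : 0 < s) (y e : E2) :
    (auxIso A s hs).symm (auxIso A s hs (s⁻¹ • y) - e) - s⁻¹ • y = A.symm (A y - e) - y := by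
  rw [auxIso_apply, auxIso_symm_apply, smul_sub, smul_inv_smul₀ hs.ne', smul_inv_smul₀ hs.ne',
    ← smul_sub, aux_dir, aux_dir, map_smul, smul_neg, inv_smul_smul₀ hs.ne']

lemma aux_dir_norm (A : E2 ≃ᵢ E2) (y : E2) :
    ‖A.symm (A y - EuclideanSpace.single (1 : Fin 2) (1 : ℝ)) - y‖ = 1 := by
  rw [aux_dir, norm_neg, LinearIsometryEquiv.norm_map]; simp

lemma aux_frontier (D : Set E2) (s : ℝ) (hs : 0 < s) :
    frontier ((fun y => s • y) ⁻¹' D) = (fun y => s • y) ⁻¹' frontier D :=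
  ((Homeomorph.smulOfNeZero s hs.ne').preimage_frontier D).symm

lemma aux_lip (φ : ℝ → ℝ) (L : NNReal) (h : LipschitzWith L φ) (s : ℝ) (hs : 0 < s) :
    LipschitzWith L (fun t => s⁻¹ * φ (s * t)) := by
  refine LipschitzWith.of_dist_le_mul fun a b => ?_
  have := h.dist_le_mul (s * a) (s * b)
  rw [Real.dist_eq] at this ⊢
  rw [Real.dist_eq] at this ⊢
  rw [← mul_sub, abs_mul, abs_of_pos hs] at this
  rw [← mul_sub, abs_mul, abs_of_pos (inv_pos.2 hs), inv_mul_le_iff₀ hs]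
  linarith

lemma aux_chart (D : Set E2) (s R : ℝ) (hs : 0 < s) (x : E2) (A : E2 ≃ᵢ E2) (φ : ℝ → ℝ)
    (h : ∀ y ∈ ball x (s * R), (y ∈ D ↔ (A y) 1 < φ ((A y) 0))) :
    ∀ y ∈ ball (s⁻¹ • x) R, (y ∈ (fun y => s • y) ⁻¹' D ↔
      (auxIso A s hs y) 1 < s⁻¹ * φ (s * (auxIso A s hs y) 0)) := by
  intro y hy
  have hy' : s • y ∈ ball x (s * R) := by
    rw [mem_ball] at hy ⊢
    have : dist (s • y) x = s * dist y (s⁻¹ • x) := by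
      conv_lhs => rw [← smul_inv_smul₀ hs.ne' x]
      rw [dist_smul₀, Real.norm_of_nonneg hs.le]
    rw [this]; gcongr
  rw [mem_preimage, h _ hy', auxIso_apply]
  simp only [PiLp.smul_apply, smul_eq_mul]
  rw [mul_inv_cancel_left₀ hs.ne']
  exact (mul_lt_mul_iff_right₀ (inv_pos.2 hs)).symm

lemma aux_infDist (D : Set E2) (s : ℝ) (hs : 0 < s) (x : E2) :
    infDist x D = s * infDist (s⁻¹ • x) ((fun y => s • y) ⁻¹' D) := by
  have h := infDist_smul₀ (inv_ne_zero hs.ne') D x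
  rw [Set.preimage_smul₀ hs.ne' D, h, norm_inv, Real.norm_of_nonneg hs.le,
    mul_inv_cancel_left₀ hs.ne']

/-- Perturbed boundary localization: if `G̃ = G + ψ` with `ψ` either `C¹ ∩ W^{1,1}` or
`W^{2,1}` and `‖ψ‖_{W^{1,1}} ≤ δ̃ ≤ min{h̃, a₁/2}`, then for every `0 < s ≤ 1`, `r = sR₀`
and every bounded open `D` Lipschitz with constants `r` and `L`, the function
`v_s = χ_D ∗ G̃_s` satisfies: (i) if `2h̃ < v_s(x) < 1 - 2h̃` then `dist(x, ∂D) ≤ m₁δr`;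
(ii) in local graph coordinates at boundary points, on the strip
`{|y₁| ≤ δ₁ r, |y₂ - φ(y₁)| ≤ δr}` one has `∇v_s(y)·(-e₂) ≥ a₁/(2s)`. -/
theorem stmt13 (L : ℝ) (hL : 0 < L)
    (δ δ₁ m₁ R₀ htil a₁ : ℝ)
    (hδ : 0 < δ) (hδ₁ : 0 < δ₁) (hδ₁' : δ₁ ≤ 1 / 2) (hm₁ : 0 < m₁) (hm₁' : m₁ ≤ 1)
    (hR₀ : 1 ≤ R₀) (hhtil : 0 < htil) (hhtil' : htil ≤ 1 / 24) (ha₁ : 0 < a₁)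
    -- the Gaussian boundary-localization estimates at scale `R₀`:
    (hloc : ∀ D : Set E2, IsOpen D → Bornology.IsBounded D → IsLipDomain R₀ L D →
      ∀ x : E2, htil < convK D Gauss x → convK D Gauss x < 1 - htil →
        Metric.infDist x (frontier D) ≤ m₁ * δ * R₀)
    (hgrad : ∀ D : Set E2, IsOpen D → Bornology.IsBounded D → IsLipDomain R₀ L D →
      ∀ x ∈ frontier D, ∀ (A : E2 ≃ᵢ E2) (φ : ℝ → ℝ),
        A x = 0 → LipschitzWith (Real.toNNReal L) φ → φ 0 = 0 →
        (∀ y ∈ ball x R₀, (y ∈ D ↔ (A y) 1 < φ ((A y) 0))) →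
        ∀ y : E2, |(A y) 0| ≤ δ₁ * R₀ →
          φ ((A y) 0) - δ * R₀ ≤ (A y) 1 → (A y) 1 ≤ φ ((A y) 0) + δ * R₀ →
          a₁ ≤ fderiv ℝ (convK D Gauss) y
            (A.symm (A y - EuclideanSpace.single (1 : Fin 2) (1 : ℝ)) - y))
    (htail : ∫ x in (ball (0 : E2) (R₀ / 2))ᶜ, ‖fderiv ℝ Gauss x‖ ≤ a₁ / 12)
    -- the perturbation `ψ`:
    (δt : ℝ) (hδt : 0 < δt) (hδt' : δt ≤ min htil (a₁ / 2))
    (ψ : E2 → ℝ) (ψ' : Fin 2 → E2 → ℝ) (hψint : Integrable ψ)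
    (hψ' : ∀ i, IsWeakPartialDeriv i ψ (ψ' i) ∧ Integrable (ψ' i))
    (hψreg : ContDiff ℝ 1 ψ ∨
      ∃ ψ'' : Fin 2 → Fin 2 → E2 → ℝ,
        ∀ i j, IsWeakPartialDeriv j (ψ' i) (ψ'' i j) ∧ Integrable (ψ'' i j))
    (hψnorm : (∫ x, |ψ x|) + (∑ i, ∫ x, |ψ' i x|) ≤ δt)
    (s : ℝ) (hs : 0 < s) (hs' : s ≤ 1)
    (D : Set E2) (hDo : IsOpen D) (hDb : Bornology.IsBounded D)
    (hDlip : IsLipDomain (s * R₀) L D) :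
    (∀ x : E2,
        2 * htil < convK D (fun z => (s⁻¹) ^ 2 * (Gauss (s⁻¹ • z) + ψ (s⁻¹ • z))) x →
        convK D (fun z => (s⁻¹) ^ 2 * (Gauss (s⁻¹ • z) + ψ (s⁻¹ • z))) x < 1 - 2 * htil →
        Metric.infDist x (frontier D) ≤ m₁ * δ * (s * R₀)) ∧
    (∀ x ∈ frontier D, ∀ (A : E2 ≃ᵢ E2) (φ : ℝ → ℝ),
      A x = 0 → LipschitzWith (Real.toNNReal L) φ → φ 0 = 0 →
      (∀ y ∈ ball x (s * R₀), (y ∈ D ↔ (A y) 1 < φ ((A y) 0))) →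
      ∀ y : E2, |(A y) 0| ≤ δ₁ * (s * R₀) →
        φ ((A y) 0) - δ * (s * R₀) ≤ (A y) 1 → (A y) 1 ≤ φ ((A y) 0) + δ * (s * R₀) →
        a₁ / (2 * s) ≤
          fderiv ℝ (convK D fun z => (s⁻¹) ^ 2 * (Gauss (s⁻¹ • z) + ψ (s⁻¹ • z))) y
            (A.symm (A y - EuclideanSpace.single (1 : Fin 2) (1 : ℝ)) - y)) := by
  have hε1 : δt ≤ htil := hδt'.trans (min_le_left _ _)
  have hε2 : δt ≤ a₁ / 2 := hδt'.trans (min_le_right _ _)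
  have hn0 : 0 ≤ ∫ x, |ψ x| := integral_nonneg fun _ => abs_nonneg _
  have hn1 : ∀ i, 0 ≤ ∫ x, |ψ' i x| := fun i => integral_nonneg fun _ => abs_nonneg _
  have hnS : 0 ≤ ∑ i, ∫ x, |ψ' i x| := Finset.sum_nonneg fun i _ => hn1 i
  set D' : Set E2 := (fun y => s • y) ⁻¹' D with hD'
  have hDo' : IsOpen D' := hDo.preimage (continuous_const_smul s)
  have hDb' : Bornology.IsBounded D' := by
    rw [hD', Set.preimage_smul₀ hs.ne' D]
    exact hDb.smul₀ _
  have hfr : frontier D' = (fun y => s • y) ⁻¹' frontier D := aux_frontier D s hs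
  have hmem : ∀ x ∈ frontier D, s⁻¹ • x ∈ frontier D' := by
    intro x hx
    rw [hfr, mem_preimage, smul_inv_smul₀ hs.ne']; exact hx
  have hDlip' : IsLipDomain R₀ L D' := by
    intro x hx
    rw [hfr] at hx
    obtain ⟨A, φ, hA, hφ, hφ0, hc⟩ := hDlip _ hx
    refine ⟨auxIso A s hs, fun t => s⁻¹ * φ (s * t), ?_, aux_lip φ _ hφ s hs, by simp [hφ0], ?_⟩
    · rw [auxIso_apply, hA, smul_zero]
    · have := aux_chart D s R₀ hs _ A φ hc
      simpa only [inv_smul_smul₀ hs.ne'] using this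
  have hadd : ∀ x, convK D' (fun z => Gauss z + ψ z) x = convK D' Gauss x + convK D' ψ x := by
    intro x
    unfold convK
    rw [← integral_add (aux_int _ (aux_ind_meas D' hDo') (aux_ind_bd D') _ aux_gauss_int x)
      (aux_int _ (aux_ind_meas D' hDo') (aux_ind_bd D') _ hψint x)]
    congr 1; ext y; ring
  have hsc : ∀ x, convK D (fun z => (s⁻¹) ^ 2 * (Gauss (s⁻¹ • z) + ψ (s⁻¹ • z))) x =
      convK D' Gauss (s⁻¹ • x) + convK D' ψ (s⁻¹ • x) := by
    intro x
    rw [← hadd]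
    exact aux_scale D (fun z => Gauss z + ψ z) s hs x
  constructor
  · intro x h1 h2
    rw [hsc] at h1 h2
    have hb := abs_le.1 (aux_convK_bd D' hDo' ψ hψint (s⁻¹ • x))
    have := hloc D' hDo' hDb' hDlip' (s⁻¹ • x) (by linarith) (by linarith)
    rw [aux_infDist _ s hs, ← hfr]
    calc s * infDist (s⁻¹ • x) (frontier D') ≤ s * (m₁ * δ * R₀) := by gcongr
      _ = _ := by ring
  · intro x hx A φ hA hφ hφ0 hc y hy0 hy1 hy2
    have hsi : 0 < s⁻¹ := inv_pos.2 hs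
    have hAy : auxIso A s hs (s⁻¹ • y) = s⁻¹ • A y := by
      rw [auxIso_apply, smul_inv_smul₀ hs.ne']
    have hg := hgrad D' hDo' hDb' hDlip' (s⁻¹ • x) (hmem x hx) (auxIso A s hs)
      (fun t => s⁻¹ * φ (s * t))
      (by rw [auxIso_apply, smul_inv_smul₀ hs.ne', hA, smul_zero]) (aux_lip φ _ hφ s hs)
      (by simp [hφ0]) (aux_chart D s R₀ hs x A φ hc) (s⁻¹ • y)
    rw [aux_dir_scale, hAy] at hg
    simp only [PiLp.smul_apply, smul_eq_mul, mul_inv_cancel_left₀ hs.ne'] at hg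
    have hss : s⁻¹ * s = 1 := inv_mul_cancel₀ hs.ne'
    have hg' := hg
      (by
        rw [abs_mul, abs_of_pos hsi, inv_mul_le_iff₀ hs]; linarith)
      (by
        have := mul_le_mul_of_nonneg_left hy1 hsi.le
        rw [mul_sub] at this
        have e : s⁻¹ * (δ * (s * R₀)) = δ * R₀ := by field_simp
        linarith)
      (by
        have := mul_le_mul_of_nonneg_left hy2 hsi.le
        rw [mul_add] at this
        have e : s⁻¹ * (δ * (s * R₀)) = δ * R₀ := by field_simp
        linarith)
    clear hg
    set w := A.symm (A y - EuclideanSpace.single (1 : Fin 2) (1 : ℝ)) - y with hw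
    have hwn : ‖w‖ = 1 := aux_dir_norm A y
    have hdG : DifferentiableAt ℝ (convK D' Gauss) (s⁻¹ • y) := by
      by_contra hcon
      rw [fderiv_zero_of_not_differentiableAt hcon] at hg'
      simp at hg'
      linarith
    have hdψ := aux_deriv D' hDo' hDb' ψ ψ' hψint hψ' (s⁻¹ • y)
    have hfun : (convK D fun z => (s⁻¹) ^ 2 * (Gauss (s⁻¹ • z) + ψ (s⁻¹ • z))) =
        fun x => (convK D' Gauss + convK D' ψ) (s⁻¹ • x) := by
      ext x; exact hsc x
    rw [hfun, fderiv_comp_smul, (hdG.hasFDerivAt.add hdψ).fderiv]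
    have hbd : |auxLin (fun i => convK D' (ψ' i) (s⁻¹ • y)) w| ≤ a₁ / 2 := by
      rw [auxLin_apply]
      refine (Finset.abs_sum_le_sum_abs _ _).trans ?_
      have : ∑ i, |convK D' (ψ' i) (s⁻¹ • y) * w i| ≤ ∑ i, ∫ x, |ψ' i x| := by
        refine Finset.sum_le_sum fun i _ => ?_
        rw [abs_mul]
        have h1 := aux_convK_bd D' hDo' (ψ' i) (hψ' i).2 (s⁻¹ • y)
        have h2 : |w i| ≤ 1 := hwn ▸ aux_coord w i
        calc _ ≤ (∫ x, |ψ' i x|) * 1 := mul_le_mul h1 h2 (abs_nonneg _) (hn1 i)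
          _ = _ := mul_one _
      linarith
    have hbd' := (abs_le.1 hbd).1
    have hfin : a₁ / 2 ≤ fderiv ℝ (convK D' Gauss) (s⁻¹ • y) w +
        auxLin (fun i => convK D' (ψ' i) (s⁻¹ • y)) w := by linarith
    calc a₁ / (2 * s) = s⁻¹ * (a₁ / 2) := by field_simp
      _ ≤ s⁻¹ * (fderiv ℝ (convK D' Gauss) (s⁻¹ • y) w +
        auxLin (fun i => convK D' (ψ' i) (s⁻¹ • y)) w) := by gcongr
      _ = _ := by simp [mul_add]
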